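/- Computable form of the Anderson–Darling statistic for the standard normal model: let n ≥ 1 and let z₁ < z₂ < … < z_n be real numbers. Let Φ denote the cumulative distribution function of the standard normal distribution N(0,1), let γ denote the standard Gaussian measure on ℝ, and let F_n : ℝ → [0,1] be the empirical distribution function F_n(x) = (1/n)·#{ i : z_i ≤ x }. Then n · ∫ℝ (Φ(x) − F_n(x))² / ( Φ(x)·(1 − Φ(x)) ) dγ(x) = −n − (1/n) Σ_{i=1}^{n} (2i − 1)·[ ln Φ(z_i) + ln(1 − Φ(z_{n−i+1})) ]. -/

import Mathlib

open MeasureTheory ProbabilityTheory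

open Filter Topology Set

lemma hasDerivAt_cdf_gaussianReal (m : ℝ) {v : NNReal} (hv : v ≠ 0) (x : ℝ) :
    HasDerivAt (cdf (gaussianReal m v)) (gaussianPDFReal m v x) x := by
  have hint := integrable_gaussianPDFReal m v
  have hcont : Continuous (gaussianPDFReal m v) := by
    rw [gaussianPDFReal_def]
    fun_prop
  have hcdf (y : ℝ) : cdf (gaussianReal m v) y = ∫ t in Iic y, gaussianPDFReal m v t := by
    rw [cdf_eq_real, measureReal_def, gaussianReal_apply_eq_integral _ hv,
      ENNReal.toReal_ofReal (integral_nonneg fun t => gaussianPDFReal_nonneg _ _ _)]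
  have heq : (cdf (gaussianReal m v) : ℝ → ℝ) =
      fun y => cdf (gaussianReal m v) 0 + ∫ t in (0 : ℝ)..y, gaussianPDFReal m v t := by
    funext y
    rw [hcdf, hcdf, ← intervalIntegral.integral_Iic_sub_Iic hint.integrableOn hint.integrableOn]
    ring
  rw [heq]
  exact (intervalIntegral.integral_hasDerivAt_right (hcont.intervalIntegrable _ _)
    (hcont.stronglyMeasurableAtFilter _ _) hcont.continuousAt).const_add _

lemma strictMono_cdf_gaussianReal (m : ℝ) {v : NNReal} (hv : v ≠ 0) :
    StrictMono (cdf (gaussianReal m v)) :=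
  strictMono_of_hasDerivAt_pos (hasDerivAt_cdf_gaussianReal m hv)
    fun x => gaussianPDFReal_pos m v x hv

lemma cdf_gaussianReal_pos (m : ℝ) {v : NNReal} (hv : v ≠ 0) (x : ℝ) :
    0 < cdf (gaussianReal m v) x :=
  (cdf_nonneg _ (x - 1)).trans_lt (strictMono_cdf_gaussianReal m hv (by linarith))

lemma cdf_gaussianReal_lt_one (m : ℝ) {v : NNReal} (hv : v ≠ 0) (x : ℝ) :
    cdf (gaussianReal m v) x < 1 :=
  (strictMono_cdf_gaussianReal m hv (by linarith)).trans_le (cdf_le_one _ (x + 1))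

lemma integrableOn_gaussianReal_iff (m : ℝ) {v : NNReal} (hv : v ≠ 0) {s : Set ℝ}
    (hs : MeasurableSet s) (f : ℝ → ℝ) :
    IntegrableOn f s (gaussianReal m v) ↔
      IntegrableOn (fun x => gaussianPDFReal m v x * f x) s := by
  rw [IntegrableOn, gaussianReal_of_var_ne_zero m hv, restrict_withDensity hs,
    integrable_withDensity_iff_integrable_smul' (measurable_gaussianPDF m v)
      (ae_of_all _ fun _ => gaussianPDF_lt_top)]
  simp [IntegrableOn, toReal_gaussianPDF]

lemma setIntegral_gaussianReal (m : ℝ) {v : NNReal} (hv : v ≠ 0) {s : Set ℝ}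
    (hs : MeasurableSet s) (f : ℝ → ℝ) :
    ∫ x in s, f x ∂(gaussianReal m v) = ∫ x in s, gaussianPDFReal m v x * f x := by
  rw [← integral_indicator hs, integral_gaussianReal_eq_integral_smul hv,
    ← integral_indicator hs]
  congr 1 with x
  by_cases hx : x ∈ s <;> simp [hx]

lemma integrableOn_inv_cdf_gaussianReal (m : ℝ) {v : NNReal} (hv : v ≠ 0) (a : ℝ) :
    IntegrableOn (fun x => (cdf (gaussianReal m v) x)⁻¹) (Ici a) (gaussianReal m v) := by
  refine Measure.integrableOn_of_bounded (M := (cdf (gaussianReal m v) a)⁻¹)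
    (measure_ne_top _ _) (monotone_cdf _).measurable.inv.aestronglyMeasurable ?_
  filter_upwards [ae_restrict_mem measurableSet_Ici] with x hx
  have ha := cdf_gaussianReal_pos m hv a
  rw [Real.norm_of_nonneg (inv_nonneg.2 (cdf_nonneg _ _))]
  exact inv_anti₀ ha (monotone_cdf _ hx)

lemma integrableOn_inv_one_sub_cdf_gaussianReal (m : ℝ) {v : NNReal} (hv : v ≠ 0) (b : ℝ) :
    IntegrableOn (fun x => (1 - cdf (gaussianReal m v) x)⁻¹) (Iic b) (gaussianReal m v) := by
  refine Measure.integrableOn_of_bounded (M := (1 - cdf (gaussianReal m v) b)⁻¹)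
    (measure_ne_top _ _)
    ((monotone_cdf _).measurable.const_sub 1).inv.aestronglyMeasurable ?_
  filter_upwards [ae_restrict_mem measurableSet_Iic] with x hx
  have hb := cdf_gaussianReal_lt_one m hv b
  rw [Real.norm_of_nonneg (inv_nonneg.2 (sub_nonneg.2 (cdf_le_one _ _)))]
  exact inv_anti₀ (by linarith) (sub_le_sub_left (monotone_cdf _ hx) 1)

lemma setIntegral_Ici_inv_cdf_gaussianReal (m : ℝ) {v : NNReal} (hv : v ≠ 0) (a : ℝ) :
    ∫ x in Ici a, (cdf (gaussianReal m v) x)⁻¹ ∂(gaussianReal m v)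
      = -Real.log (cdf (gaussianReal m v) a) := by
  have hderiv (x : ℝ) : HasDerivAt (fun y => Real.log (cdf (gaussianReal m v) y))
      (gaussianPDFReal m v x * (cdf (gaussianReal m v) x)⁻¹) x := by
    simpa [div_eq_mul_inv] using
      (hasDerivAt_cdf_gaussianReal m hv x).log (cdf_gaussianReal_pos m hv x).ne'
  have hint := (integrableOn_gaussianReal_iff m hv measurableSet_Ici _).1
    (integrableOn_inv_cdf_gaussianReal m hv a)
  have hlim : Tendsto (fun y => Real.log (cdf (gaussianReal m v) y)) atTop (𝓝 0) := by
    simpa using (tendsto_cdf_atTop (gaussianReal m v)).log one_ne_zero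
  rw [setIntegral_gaussianReal m hv measurableSet_Ici, integral_Ici_eq_integral_Ioi,
    integral_Ioi_of_hasDerivAt_of_tendsto' (fun x _ => hderiv x)
      (hint.mono_set Ioi_subset_Ici_self) hlim, zero_sub]

lemma setIntegral_Iic_inv_one_sub_cdf_gaussianReal (m : ℝ) {v : NNReal} (hv : v ≠ 0) (b : ℝ) :
    ∫ x in Iic b, (1 - cdf (gaussianReal m v) x)⁻¹ ∂(gaussianReal m v)
      = -Real.log (1 - cdf (gaussianReal m v) b) := by
  have hderiv (x : ℝ) : HasDerivAt (fun y => -Real.log (1 - cdf (gaussianReal m v) y))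
      (gaussianPDFReal m v x * (1 - cdf (gaussianReal m v) x)⁻¹) x := by
    have hx := cdf_gaussianReal_lt_one m hv x
    have h := (((hasDerivAt_cdf_gaussianReal m hv x).const_sub 1).log (by linarith)).neg
    rwa [neg_div, neg_neg, div_eq_mul_inv] at h
  have hint := (integrableOn_gaussianReal_iff m hv measurableSet_Iic _).1
    (integrableOn_inv_one_sub_cdf_gaussianReal m hv b)
  have hlim : Tendsto (fun y => -Real.log (1 - cdf (gaussianReal m v) y)) atBot (𝓝 0) := by
    simpa using (((tendsto_cdf_atBot (gaussianReal m v)).const_sub 1).log (by simp)).neg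
  rw [setIntegral_gaussianReal m hv measurableSet_Iic,
    integral_Iic_of_hasDerivAt_of_tendsto' (fun x _ => hderiv x) hint hlim, sub_zero]

/-- The square of the size of an initial segment of `Fin n` is a sum of odd numbers. -/
lemma sq_card_filter_eq_sum_of_antitone {n : ℕ} (P : Fin n → Prop) [DecidablePred P]
    (hP : ∀ i j, i ≤ j → P j → P i) :
    ((Finset.univ.filter P).card : ℝ) ^ 2 =
      ∑ i : Fin n, (2 * (i : ℝ) + 1) * if P i then 1 else 0 := by
  rw [Finset.card_filter]
  push_cast
  induction n with
  | zero => simp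
  | succ n ih =>
    have h := ih (fun i => P i.castSucc) fun i j hij => hP _ _ (by simpa using hij)
    rw [Fin.sum_univ_castSucc, Fin.sum_univ_castSucc]
    simp only [Fin.val_castSucc, Fin.val_last]
    rw [← h]
    by_cases hl : P (Fin.last n)
    · have hall (i : Fin n) : P i.castSucc := hP _ _ (Fin.le_last _) hl
      simp only [hl, hall, if_true, Finset.sum_const, Finset.card_univ, Fintype.card_fin,
        nsmul_eq_mul]
      ring
    · simp [hl]

/-- The Anderson–Darling integrand expanded by partial fractions. -/
lemma sq_sub_edf_div_eq {n : ℕ} (hn : 1 ≤ n) {z : Fin n → ℝ} (hz : Monotone z) (x : ℝ)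
    {t : ℝ} (h0 : 0 < t) (h1 : t < 1) :
    (t - ((Finset.univ.filter (fun i => z i ≤ x)).card : ℝ) / n) ^ 2 / (t * (1 - t)) =
      (∑ i : Fin n, (2 * (i : ℝ) + 1) / n ^ 2 *
        ((Ici (z i)).indicator (fun _ => t⁻¹) x
          + (Iio (z i.rev)).indicator (fun _ => (1 - t)⁻¹) x)) - 1 := by
  have hn0 : (n : ℝ) ≠ 0 := by positivity
  have hle := sq_card_filter_eq_sum_of_antitone (fun i => z i ≤ x)
    fun i j hij hj => (hz hij).trans hj
  have hlt := sq_card_filter_eq_sum_of_antitone (fun i : Fin n => x < z i.rev)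
    fun i j hij hj => hj.trans_le (hz (Fin.rev_le_rev.2 hij))
  have hcard : ((Finset.univ.filter (fun i : Fin n => x < z i.rev)).card : ℝ) =
      n - (Finset.univ.filter (fun i => z i ≤ x)).card := by
    have hrev : (Finset.univ.filter (fun i : Fin n => x < z i.rev)).card =
        (Finset.univ.filter (fun i : Fin n => ¬ z i ≤ x)).card := by
      simp only [Finset.card_filter, not_le]
      exact Equiv.sum_comp Fin.revPerm (fun i => if x < z i then 1 else 0)
    have hadd := Finset.card_filter_add_card_filter_not (s := (Finset.univ : Finset (Fin n)))
      (fun i => z i ≤ x)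
    rw [Finset.card_univ, Fintype.card_fin] at hadd
    rw [hrev, eq_sub_iff_add_eq', ← Nat.cast_add, hadd]
  rw [hcard] at hlt
  have hsum : (∑ i : Fin n, (2 * (i : ℝ) + 1) / n ^ 2 *
        ((Ici (z i)).indicator (fun _ => t⁻¹) x
          + (Iio (z i.rev)).indicator (fun _ => (1 - t)⁻¹) x)) =
      t⁻¹ / n ^ 2 * (∑ i : Fin n, (2 * (i : ℝ) + 1) * if z i ≤ x then 1 else 0) +
      (1 - t)⁻¹ / n ^ 2 *
        (∑ i : Fin n, (2 * (i : ℝ) + 1) * if x < z i.rev then 1 else 0) := by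
    rw [Finset.mul_sum, Finset.mul_sum, ← Finset.sum_add_distrib]
    refine Finset.sum_congr rfl fun i _ => ?_
    simp only [indicator_apply, mem_Ici, mem_Iio]
    split_ifs <;> ring
  rw [hsum, ← hle, ← hlt]
  have h1' : 1 - t ≠ 0 := by linarith
  field_simp
  ring

/-- Computable form of the Anderson–Darling statistic for the standard normal model: for
sorted reals `z₁ < ⋯ < zₙ`, with `Φ` the standard normal CDF, `γ` the standard Gaussian
measure and `Fₙ` the empirical distribution function,
`n ∫ (Φ(x) - Fₙ(x))² / (Φ(x)(1 - Φ(x))) dγ(x)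
  = -n - (1/n) ∑ᵢ (2i - 1)(ln Φ(zᵢ) + ln (1 - Φ(z_{n-i+1})))`. -/
theorem anderson_darling_computable_form (n : ℕ) (hn : 1 ≤ n)
    (z : Fin n → ℝ) (hz : StrictMono z) :
    (n : ℝ) * ∫ x,
        (cdf (gaussianReal 0 1) x
            - ((Finset.univ.filter (fun i => z i ≤ x)).card : ℝ) / n) ^ 2 /
          (cdf (gaussianReal 0 1) x * (1 - cdf (gaussianReal 0 1) x))
        ∂(gaussianReal 0 1)
      = -(n : ℝ) - (1 / (n : ℝ)) * ∑ i : Fin n, (2 * (i : ℝ) + 1) *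
          (Real.log (cdf (gaussianReal 0 1) (z i))
            + Real.log (1 - cdf (gaussianReal 0 1) (z i.rev))) := by
  have hv : (1 : NNReal) ≠ 0 := one_ne_zero
  have := nullSingletonClass_gaussianReal (μ := 0) hv
  have hn0 : (n : ℝ) ≠ 0 := by positivity
  have hIci (i : Fin n) := (integrableOn_inv_cdf_gaussianReal 0 hv (z i)).integrable_indicator
    measurableSet_Ici
  have hIio (i : Fin n) := ((integrableOn_inv_one_sub_cdf_gaussianReal 0 hv
    (z i.rev)).mono_set Iio_subset_Iic_self).integrable_indicator measurableSet_Iio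
  have hterm (i : Fin n) := ((hIci i).add (hIio i)).const_mul ((2 * (i : ℝ) + 1) / n ^ 2)
  simp only [Pi.add_apply] at hterm
  have hintegrand : ∀ x, (cdf (gaussianReal 0 1) x
            - ((Finset.univ.filter (fun i => z i ≤ x)).card : ℝ) / n) ^ 2 /
          (cdf (gaussianReal 0 1) x * (1 - cdf (gaussianReal 0 1) x)) =
      (∑ i : Fin n, (2 * (i : ℝ) + 1) / n ^ 2 *
        ((Ici (z i)).indicator (fun y => (cdf (gaussianReal 0 1) y)⁻¹) x
          + (Iio (z i.rev)).indicator (fun y => (1 - cdf (gaussianReal 0 1) y)⁻¹) x)) - 1 :=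
    fun x => sq_sub_edf_div_eq hn hz.monotone x (cdf_gaussianReal_pos 0 hv x)
      (cdf_gaussianReal_lt_one 0 hv x)
  simp_rw [hintegrand]
  rw [integral_sub (integrable_finsetSum _ fun i _ => hterm i) (integrable_const _),
    integral_finsetSum _ fun i _ => hterm i]
  have hval (i : Fin n) : ∫ x, (2 * (i : ℝ) + 1) / n ^ 2 *
        ((Ici (z i)).indicator (fun y => (cdf (gaussianReal 0 1) y)⁻¹) x
          + (Iio (z i.rev)).indicator (fun y => (1 - cdf (gaussianReal 0 1) y)⁻¹) x)
        ∂(gaussianReal 0 1) =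
      -(1 / (n : ℝ) ^ 2) * ((2 * (i : ℝ) + 1) * (Real.log (cdf (gaussianReal 0 1) (z i))
            + Real.log (1 - cdf (gaussianReal 0 1) (z i.rev)))) := by
    rw [integral_const_mul, integral_add (hIci i) (hIio i),
      integral_indicator measurableSet_Ici, integral_indicator measurableSet_Iio,
      ← integral_Iic_eq_integral_Iio, setIntegral_Ici_inv_cdf_gaussianReal 0 hv,
      setIntegral_Iic_inv_one_sub_cdf_gaussianReal 0 hv]
    ring
  simp_rw [hval]
  rw [← Finset.mul_sum, integral_const, probReal_univ, one_smul]
  field_simp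
  ring
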